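/- arXiv:1811.10425 — 2 statements merged into one kernel-verified Lean document; each statement's English description precedes it below -/
import Mathlib

section
/- Let A and B be unital *-subalgebras of M_n that are quasiorthogonal: tr(AB) = n^{-1} tr(A) tr(B) for all A ∈ A, B ∈ B. Then dim(A) · dim(B) ≤ n², where dimensions are as complex vector subspaces of M_n. -/
open Matrix ComplexOrder

/-- The completely positive map with Kraus operators `V i`. -/
noncomputable def krausMap {d n m : ℕ} (V : Fin d → Matrix (Fin m) (Fin n) ℂ) :
    Matrix (Fin n) (Fin n) ℂ →ₗ[ℂ] Matrix (Fin m) (Fin m) ℂ where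
  toFun X := ∑ i, V i * X * (V i)ᴴ
  map_add' X Y := by simp [Matrix.mul_add, Matrix.add_mul, Finset.sum_add_distrib]
  map_smul' c X := by simp [Matrix.mul_smul, Matrix.smul_mul, Finset.smul_sum]

/-- The complementary map `Φ^C(ρ) = ∑_{i,j} tr(ρ V_j* V_i) E_{ij}`. -/
noncomputable def complMap {d n m : ℕ} (V : Fin d → Matrix (Fin m) (Fin n) ℂ) :
    Matrix (Fin n) (Fin n) ℂ →ₗ[ℂ] Matrix (Fin d) (Fin d) ℂ where
  toFun X := Matrix.of fun i j => (X * ((V j)ᴴ * V i)).trace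
  map_add' X Y := by
    ext i j
    simp [Matrix.add_mul]
  map_smul' c X := by
    ext i j
    simp [Matrix.smul_mul]

/-- The compression map `P_Q(X) = Q X Q`. -/
noncomputable def comprMap {n : ℕ} (Q : Matrix (Fin n) (Fin n) ℂ) :
    Matrix (Fin n) (Fin n) ℂ →ₗ[ℂ] Matrix (Fin n) (Fin n) ℂ where
  toFun X := Q * X * Q
  map_add' X Y := by simp [Matrix.mul_add, Matrix.add_mul]
  map_smul' c X := by simp [Matrix.mul_smul, Matrix.smul_mul]

/-- The orthogonal complement of a set of matrices with respect to the trace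
(Hilbert–Schmidt) inner product `⟨A, B⟩ = tr(A* B)`. -/
noncomputable def traceOrthCompl {n : ℕ} (S : Set (Matrix (Fin n) (Fin n) ℂ)) :
    Submodule ℂ (Matrix (Fin n) (Fin n) ℂ) where
  carrier := {X | ∀ A ∈ S, (Aᴴ * X).trace = 0}
  add_mem' := by
    intro a b ha hb A hA
    simp [Matrix.mul_add, ha A hA, hb A hA]
  zero_mem' := by intro A hA; simp
  smul_mem' := by
    intro c x hx A hA
    simp [Matrix.mul_smul, hx A hA]

/-- The commutant of a set of matrices, as a submodule of `M_n`. -/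
noncomputable def commutantSub {n : ℕ} (S : Set (Matrix (Fin n) (Fin n) ℂ)) :
    Submodule ℂ (Matrix (Fin n) (Fin n) ℂ) where
  carrier := {X | ∀ A ∈ S, X * A = A * X}
  add_mem' := by
    intro a b ha hb A hA
    simp [Matrix.mul_add, Matrix.add_mul, ha A hA, hb A hA]
  zero_mem' := by intro A hA; simp
  smul_mem' := by
    intro c x hx A hA
    simp [Matrix.mul_smul, Matrix.smul_mul, hx A hA]

/-- The multiplicative domain of a linear map on `M_n`, as a set. -/
noncomputable def multDomain {n m : ℕ}
    (Φ : Matrix (Fin n) (Fin n) ℂ →ₗ[ℂ] Matrix (Fin m) (Fin m) ℂ) :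
    Set (Matrix (Fin n) (Fin n) ℂ) :=
  {A | ∀ X, Φ (A * X) = Φ A * Φ X ∧ Φ (X * A) = Φ X * Φ A}

/-- if `A` and `B` are quasiorthogonal unital *-subalgebras of `M_n`,
then `dim(A) · dim(B) ≤ n²`. -/
theorem stmt_16 {n : ℕ}
    (A B : StarSubalgebra ℂ (Matrix (Fin n) (Fin n) ℂ))
    (hquasi : ∀ a ∈ A, ∀ b ∈ B, (a * b).trace = (n : ℂ)⁻¹ * a.trace * b.trace) :
    Module.finrank ℂ A * Module.finrank ℂ B ≤ n ^ 2 := by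
  classical
  rcases Nat.eq_zero_or_pos n with rfl | hn
  · have h : Module.finrank ℂ A = 0 := Module.finrank_zero_of_subsingleton
    simp [h]
  have hn0 : (n : ℂ)⁻¹ ≠ 0 := inv_ne_zero (by exact_mod_cast hn.ne')
  haveI : Module.Finite ℂ A :=
    Module.Finite.of_injective A.subtype.toAlgHom.toLinearMap Subtype.val_injective
  haveI : Module.Finite ℂ B :=
    Module.Finite.of_injective B.subtype.toAlgHom.toLinearMap Subtype.val_injective
  let a := Module.finBasis ℂ A
  let b := Module.finBasis ℂ B
  have key : LinearIndependent ℂ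
      (fun p : Fin (Module.finrank ℂ A) × Fin (Module.finrank ℂ B) =>
        ((a p.1 : Matrix (Fin n) (Fin n) ℂ) * (b p.2 : Matrix (Fin n) (Fin n) ℂ))) := by
    rw [Fintype.linearIndependent_iff]
    intro c hc
    rw [Fintype.sum_prod_type] at hc
    have h1 : ∀ x : A, ∀ y : B,
        ∑ i, ∑ j, c (i, j) * (((x : Matrix (Fin n) (Fin n) ℂ)ᴴ * (a i).1).trace *
          ((b j).1 * (y : Matrix (Fin n) (Fin n) ℂ)ᴴ).trace) = 0 := by
      intro x y
      have h2 : ((x : Matrix (Fin n) (Fin n) ℂ)ᴴ *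
          (∑ i, ∑ j, c (i, j) • ((a i).1 * (b j).1)) *
          (y : Matrix (Fin n) (Fin n) ℂ)ᴴ).trace = 0 := by
        rw [hc]; simp
      have h3 : (n : ℂ)⁻¹ * ∑ i, ∑ j, c (i, j) * (((x : Matrix (Fin n) (Fin n) ℂ)ᴴ *
          (a i).1).trace * ((b j).1 * (y : Matrix (Fin n) (Fin n) ℂ)ᴴ).trace) = 0 := by
        rw [← h2]
        simp only [Finset.mul_sum, Finset.sum_mul, Matrix.trace_sum]
        refine Finset.sum_congr rfl fun i _ => Finset.sum_congr rfl fun j _ => ?_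
        have h4 := hquasi _ (mul_mem (star_mem x.2) (a i).2) _
          (mul_mem (b j).2 (star_mem y.2))
        simp only [Matrix.star_eq_conjTranspose] at h4
        rw [Matrix.mul_smul, Matrix.smul_mul, Matrix.trace_smul, smul_eq_mul]
        have h5 : (x : Matrix (Fin n) (Fin n) ℂ)ᴴ * ((a i).1 * (b j).1) *
            (y : Matrix (Fin n) (Fin n) ℂ)ᴴ = ((x : Matrix (Fin n) (Fin n) ℂ)ᴴ * (a i).1) *
            ((b j).1 * (y : Matrix (Fin n) (Fin n) ℂ)ᴴ) := by
          simp only [Matrix.mul_assoc]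
        rw [h5, h4]
        ring
      exact (mul_eq_zero.mp h3).resolve_left hn0
    have h6 : ∀ y : B, ∀ i,
        ∑ j, c (i, j) * ((b j).1 * (y : Matrix (Fin n) (Fin n) ℂ)ᴴ).trace = 0 := by
      intro y
      apply Fintype.linearIndependent_iff.mp a.linearIndependent
      set x : A := ∑ i, (∑ j, c (i, j) *
        ((b j).1 * (y : Matrix (Fin n) (Fin n) ℂ)ᴴ).trace) • a i with hx
      have hx1 : x.1 = ∑ i, (∑ j, c (i, j) *
        ((b j).1 * (y : Matrix (Fin n) (Fin n) ℂ)ᴴ).trace) • (a i).1 := by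
        rw [hx]; simp
      have h7 : (x.1ᴴ * x.1).trace = 0 := by
        rw [← h1 x y]
        conv_lhs => rw [show x.1ᴴ * x.1 = x.1ᴴ * _ from congrArg (x.1ᴴ * ·) hx1]
        simp only [Finset.mul_sum, Matrix.trace_sum, Matrix.mul_smul, Matrix.trace_smul,
          smul_eq_mul, Finset.sum_mul]
        refine Finset.sum_congr rfl fun i _ => Finset.sum_congr rfl fun j _ => ?_
        ring
      exact Subtype.ext (Matrix.trace_conjTranspose_mul_self_eq_zero_iff.mp h7)
    rintro ⟨i, j⟩
    refine Fintype.linearIndependent_iff.mp b.linearIndependent (fun j => c (i, j)) ?_ j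
    set y : B := ∑ j, c (i, j) • b j with hy
    have hy1 : y.1 = ∑ j, c (i, j) • (b j).1 := by
      rw [hy]; simp
    have h8 : (y.1 * y.1ᴴ).trace = 0 := by
      rw [← h6 y i]
      conv_lhs => rw [show y.1 * y.1ᴴ = _ * y.1ᴴ from congrArg (· * y.1ᴴ) hy1]
      simp only [Matrix.trace_sum, Matrix.smul_mul, Matrix.trace_smul,
        smul_eq_mul, Finset.sum_mul]
    exact Subtype.ext (Matrix.trace_mul_conjTranspose_self_eq_zero_iff.mp h8)
  have := key.fintype_card_le_finrank
  simpa [Module.finrank_matrix, sq] using this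
end

section
/- Let A and B be unital *-subalgebras of M_n with A correctable and B privatized to a state by some quantum channel Φ (equivalently, A and B quasiorthogonal). Then dim(B) ≤ dim(A') and dim(A) ≤ dim(B'), where A' denotes the commutant in M_n. -/
open Matrix ComplexOrder

section helpers

lemma onb_exists {n : ℕ} (W : Submodule ℂ (Matrix (Fin n) (Fin n) ℂ)) :
    ∃ a : Fin (Module.finrank ℂ W) → Matrix (Fin n) (Fin n) ℂ,
      (∀ i, a i ∈ W) ∧ (∀ i j, ((a i)ᴴ * a j).trace = if i = j then 1 else 0) ∧
      (∀ x ∈ W, x = ∑ i, ((a i)ᴴ * x).trace • a i) := by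
  let e : Matrix (Fin n) (Fin n) ℂ ≃ₗ[ℂ] EuclideanSpace ℂ (Fin n × Fin n) :=
    (LinearEquiv.curry ℂ ℂ (Fin n) (Fin n)).symm.trans (WithLp.linearEquiv 2 ℂ (Fin n × Fin n → ℂ)).symm
  have he : ∀ x i j, e x (i, j) = x i j := fun x i j => rfl
  have hin : ∀ x y, inner ℂ (e x) (e y) = (xᴴ * y).trace := by
    intro x y
    rw [PiLp.inner_apply, Fintype.sum_prod_type]
    simp only [he, Matrix.trace, Matrix.diag, Matrix.mul_apply, Matrix.conjTranspose_apply]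
    rw [Finset.sum_comm]
    simp [mul_comm]
  let W' := W.map e.toLinearMap
  have hd : Module.finrank ℂ W' = Module.finrank ℂ W := LinearEquiv.finrank_map_eq e W
  let b := (stdOrthonormalBasis ℂ W').reindex (finCongr hd)
  have hea : ∀ i, e (e.symm (b i : EuclideanSpace ℂ (Fin n × Fin n))) = b i := fun i => by simp
  refine ⟨fun i => e.symm (b i), ?_, ?_, ?_⟩
  · intro i
    obtain ⟨w, hw, h⟩ := (b i).2
    have h2 : e.symm (b i : EuclideanSpace ℂ (Fin n × Fin n)) = w := by
      rw [← h]; exact e.symm_apply_apply w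
    show e.symm (b i : EuclideanSpace ℂ (Fin n × Fin n)) ∈ W
    rw [h2]; exact hw
  · intro i j
    rw [← hin, hea, hea]
    have := orthonormal_iff_ite.1 b.orthonormal i j
    simpa using this
  · intro x hx
    apply e.injective
    have h := b.sum_repr' ⟨e x, ⟨x, hx, rfl⟩⟩
    have h2 := congrArg (Subtype.val) h
    simp only [Submodule.coe_sum, Submodule.coe_smul, Submodule.coe_inner] at h2
    rw [map_sum]
    simp only [map_smul, hea, ← hin]
    exact h2.symm

lemma trace_mulLR {n : ℕ} (M N : Matrix (Fin n) (Fin n) ℂ) :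
    LinearMap.trace ℂ _ (LinearMap.mulLeft ℂ M ∘ₗ LinearMap.mulRight ℂ N) =
      M.trace * N.trace := by
  rw [LinearMap.trace_eq_matrix_trace ℂ (Matrix.stdBasis ℂ (Fin n) (Fin n)), Matrix.trace]
  simp only [Matrix.diag, LinearMap.toMatrix_apply, Fintype.sum_prod_type, Matrix.stdBasis_eq_single]
  have : ∀ (X : Matrix (Fin n) (Fin n) ℂ) i j,
      (Matrix.stdBasis ℂ (Fin n) (Fin n)).repr X (i, j) = X i j := by
    intro X i j
    simp [Matrix.stdBasis]
  simp only [this]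
  simp [Matrix.trace, Finset.sum_mul_sum, Matrix.mul_apply, Matrix.single_apply, ite_and]

lemma quasi {d n m : ℕ} (hn : 0 < n)
    (V : Fin d → Matrix (Fin m) (Fin n) ℂ)
    (hV : ∑ i, (V i)ᴴ * V i = 1)
    (A B : StarSubalgebra ℂ (Matrix (Fin n) (Fin n) ℂ))
    (hcorr : ∀ a ∈ A, ∀ i j, a * ((V i)ᴴ * V j) = ((V i)ᴴ * V j) * a)
    (hpriv : ∃ ρ : Matrix (Fin m) (Fin m) ℂ, ρ.PosSemidef ∧ ρ.trace = 1 ∧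
        ∀ b ∈ B, krausMap V b = b.trace • ρ) :
    ∀ a ∈ A, ∀ b ∈ B, (a * b).trace = a.trace * b.trace / n := by
  intro a ha b hb
  obtain ⟨ρ, -, -, hρ⟩ := hpriv
  have hn' : (n : ℂ) ≠ 0 := by exact_mod_cast hn.ne'
  have htr : ∀ X, (krausMap V X).trace = X.trace := by
    intro X
    simp only [krausMap, LinearMap.coe_mk, AddHom.coe_mk, Matrix.trace_sum]
    calc _ = ∑ i, ((V i)ᴴ * V i * X).trace := by
          refine Finset.sum_congr rfl fun i _ => ?_
          rw [Matrix.trace_mul_comm, Matrix.mul_assoc]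
      _ = _ := by rw [← Matrix.trace_sum, ← Finset.sum_mul, hV, one_mul]
  have hmul : ∀ X, krausMap V a * krausMap V X = krausMap V 1 * krausMap V (a * X) := by
    intro X
    simp only [krausMap, LinearMap.coe_mk, AddHom.coe_mk, Finset.sum_mul_sum]
    refine Finset.sum_congr rfl fun i _ => Finset.sum_congr rfl fun j _ => ?_
    calc _ = V i * (a * ((V i)ᴴ * V j)) * X * (V j)ᴴ := by simp only [Matrix.mul_assoc]
      _ = _ := by rw [hcorr a ha]; simp only [Matrix.mul_assoc, Matrix.mul_one, Matrix.one_mul]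
  let Y := a * (b - (b.trace / n) • (1 : Matrix (Fin n) (Fin n) ℂ))
  have h1 : krausMap V 1 * krausMap V Y = 0 := by
    rw [← hmul, map_sub, map_smul, hρ b hb, hρ 1 (one_mem B), smul_smul]
    simp [hn']
  have hj : ∀ j, (V j)ᴴ * krausMap V Y = 0 := by
    have h2 : ∑ j, ((V j)ᴴ * krausMap V Y)ᴴ * ((V j)ᴴ * krausMap V Y) = 0 := by
      have : (krausMap V Y)ᴴ * (krausMap V 1 * krausMap V Y) = 0 := by rw [h1, Matrix.mul_zero]
      rw [← this]
      conv_rhs => enter [2, 1]; simp only [krausMap, LinearMap.coe_mk, AddHom.coe_mk]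
      rw [Finset.sum_mul, Finset.mul_sum]
      refine Finset.sum_congr rfl fun i _ => ?_
      simp [Matrix.mul_assoc]
    intro j
    have h3 := congrArg Matrix.trace h2
    rw [Matrix.trace_sum, Matrix.trace_zero, Finset.sum_eq_zero_iff_of_nonneg] at h3
    · exact Matrix.trace_conjTranspose_mul_self_eq_zero_iff.1 (h3 j (Finset.mem_univ _))
    · intro i _
      exact (Matrix.posSemidef_conjTranspose_mul_self _).trace_nonneg
  have h4 : (krausMap V Y)ᴴ * krausMap V Y = 0 := by
    conv_lhs => enter [1]; simp only [krausMap, LinearMap.coe_mk, AddHom.coe_mk]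
    rw [Matrix.conjTranspose_sum, Finset.sum_mul]
    refine Finset.sum_eq_zero fun i _ => ?_
    rw [Matrix.conjTranspose_mul, Matrix.conjTranspose_mul, Matrix.conjTranspose_conjTranspose]
    -- V i * (Yᴴ * (V i)ᴴ) * Φ
    rw [Matrix.mul_assoc, Matrix.mul_assoc, hj, Matrix.mul_zero, Matrix.mul_zero]
  have h5 : krausMap V Y = 0 := Matrix.conjTranspose_mul_self_eq_zero.1 h4
  have h6 := htr Y
  rw [h5, Matrix.trace_zero] at h6
  have h7 : Y.trace = (a * b).trace - a.trace * b.trace / n := by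
    simp only [Y, Matrix.mul_sub, Matrix.mul_smul, Matrix.mul_one, Matrix.trace_sub,
      Matrix.trace_smul, smul_eq_mul]
    ring
  rw [h7] at h6
  exact (sub_eq_zero.1 h6.symm)

lemma dim_mul_le {n : ℕ} (hn : 0 < n)
    (A B : StarSubalgebra ℂ (Matrix (Fin n) (Fin n) ℂ))
    (h : ∀ a ∈ A, ∀ b ∈ B, (a * b).trace = a.trace * b.trace / n) :
    Module.finrank ℂ A * Module.finrank ℂ B ≤ n ^ 2 := by
  have hn' : (n : ℂ) ≠ 0 := by exact_mod_cast hn.ne'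
  obtain ⟨a, haA, hao, -⟩ := onb_exists A.toSubalgebra.toSubmodule
  obtain ⟨b, hbB, hbo, -⟩ := onb_exists B.toSubalgebra.toSubmodule
  have key : ∀ i j k l, ((a i * (b j)ᴴ)ᴴ * (a k * (b l)ᴴ)).trace =
      if i = k ∧ j = l then (1 / n : ℂ) else 0 := by
    intro i j k l
    have e : ((a i * (b j)ᴴ)ᴴ * (a k * (b l)ᴴ)).trace =
        (((a i)ᴴ * a k) * ((b l)ᴴ * b j)).trace := by
      rw [Matrix.conjTranspose_mul, Matrix.conjTranspose_conjTranspose, Matrix.mul_assoc,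
        Matrix.trace_mul_comm]
      simp only [Matrix.mul_assoc]
    have hi : (a i)ᴴ * a k ∈ A := mul_mem (star_mem (haA i)) (haA k)
    have hj : (b l)ᴴ * b j ∈ B := mul_mem (star_mem (hbB l)) (hbB j)
    rw [e, h _ hi _ hj, hao, hbo]
    by_cases h1 : i = k <;> by_cases h2 : j = l <;> simp [h1, h2, eq_comm]
  have li : LinearIndependent ℂ (fun p : Fin (Module.finrank ℂ A.toSubalgebra.toSubmodule) ×
      Fin (Module.finrank ℂ B.toSubalgebra.toSubmodule) => a p.1 * (b p.2)ᴴ) := by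
    rw [Fintype.linearIndependent_iff]
    intro g hg p
    have h2 := congrArg (fun X => ((a p.1 * (b p.2)ᴴ)ᴴ * X).trace) hg
    simp only [Finset.mul_sum, Matrix.mul_smul, Matrix.trace_sum, Matrix.trace_smul, key,
      Matrix.mul_zero, Matrix.trace_zero, ← Prod.ext_iff] at h2
    simpa [hn'] using h2
  have := li.fintype_card_le_finrank
  simp [Module.finrank_matrix] at this
  rw [sq]
  exact this

lemma finrank_pos_alg {n : ℕ} (hn : 0 < n)
    (A : StarSubalgebra ℂ (Matrix (Fin n) (Fin n) ℂ)) : 0 < Module.finrank ℂ A := by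
  have : Nonempty (Fin n) := ⟨⟨0, hn⟩⟩
  have : Nontrivial A := ⟨⟨0, 1, fun h => zero_ne_one (congrArg Subtype.val h)⟩⟩
  have : Module.Finite ℂ A := inferInstanceAs (Module.Finite ℂ A.toSubalgebra.toSubmodule)
  exact Module.finrank_pos

lemma dim_comm {n : ℕ} (hn : 0 < n)
    (A : StarSubalgebra ℂ (Matrix (Fin n) (Fin n) ℂ)) :
    n ^ 2 ≤ Module.finrank ℂ A *
      Module.finrank ℂ (commutantSub (A : Set (Matrix (Fin n) (Fin n) ℂ))) := by
  obtain ⟨a, haA, hao, hax⟩ := onb_exists A.toSubalgebra.toSubmodule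
  have haA : ∀ i, a i ∈ A := haA
  have hax : ∀ x ∈ A, x = ∑ i, ((a i)ᴴ * x).trace • a i := hax
  have hT : ∀ X, ∀ x ∈ A, (∑ i, a i * X * (a i)ᴴ) * x = x * ∑ i, a i * X * (a i)ᴴ := by
    intro X x hx
    have e1 : ∀ i, x * a i = ∑ j, ((a j)ᴴ * x * a i).trace • a j := fun i => by
      simpa only [Matrix.mul_assoc] using hax _ (mul_mem hx (haA i))
    have e2 : ∀ j, (a j)ᴴ * x = ∑ i, ((a j)ᴴ * x * a i).trace • (a i)ᴴ := fun j => by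
      have := congrArg Matrix.conjTranspose (hax _ (mul_mem (star_mem hx) (haA j)))
      rw [Matrix.conjTranspose_sum] at this
      simp only [Matrix.conjTranspose_smul, ← Matrix.trace_conjTranspose,
        Matrix.conjTranspose_mul, Matrix.star_eq_conjTranspose,
        Matrix.conjTranspose_conjTranspose] at this
      exact this
    rw [Finset.sum_mul, Finset.mul_sum]
    have l : ∀ j, a j * X * (a j)ᴴ * x = ∑ i, ((a j)ᴴ * x * a i).trace • (a j * X * (a i)ᴴ) := by
      intro j
      rw [Matrix.mul_assoc]
      conv_lhs => rw [e2, Finset.mul_sum]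
      simp only [Matrix.mul_smul]
    have r : ∀ i, x * (a i * X * (a i)ᴴ) = ∑ j, ((a j)ᴴ * x * a i).trace • (a j * X * (a i)ᴴ) := by
      intro i
      rw [← Matrix.mul_assoc, ← Matrix.mul_assoc, e1, Finset.sum_mul, Finset.sum_mul]
      simp only [Matrix.smul_mul]
    simp only [l, r]
    exact Finset.sum_comm
  let c : Matrix (Fin n) (Fin n) ℂ := ∑ i, a i * (a i)ᴴ
  have hcA : ∀ x ∈ A, c * x = x * c := fun x hx => by
    have := hT 1 x hx
    simp only [Matrix.mul_one] at this
    exact this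
  have hcps : c.PosSemidef :=
    Matrix.posSemidef_sum _ fun i _ => Matrix.posSemidef_self_mul_conjTranspose (a i)
  have h1 : (1 : Matrix (Fin n) (Fin n) ℂ) = ∑ i, (a i).trace • (a i)ᴴ := by
    have := congrArg Matrix.conjTranspose (hax 1 (one_mem A))
    simpa [Matrix.conjTranspose_sum, Matrix.conjTranspose_smul, ← Matrix.trace_conjTranspose]
      using this
  have hcu : IsUnit c := by
    rw [← Matrix.mulVec_injective_iff_isUnit]
    rw [← Matrix.coe_mulVecLin, ← LinearMap.ker_eq_bot, LinearMap.ker_eq_bot']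
    intro x hx
    have hx : c *ᵥ x = 0 := hx
    have h2 : ∑ i, star ((a i)ᴴ *ᵥ x) ⬝ᵥ ((a i)ᴴ *ᵥ x) = 0 := by
      have : star x ⬝ᵥ (c *ᵥ x) = 0 := by rw [hx, dotProduct_zero]
      rw [← this]
      simp only [c, Matrix.sum_mulVec, dotProduct_sum, Matrix.star_mulVec,
        Matrix.conjTranspose_conjTranspose, ← Matrix.mulVec_mulVec, Matrix.dotProduct_mulVec]
    rw [Finset.sum_eq_zero_iff_of_nonneg (fun i _ => dotProduct_star_self_nonneg _)] at h2
    have h3 : ∀ i, (a i)ᴴ *ᵥ x = 0 := fun i =>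
      dotProduct_star_self_eq_zero.1 (h2 i (Finset.mem_univ _))
    rw [← Matrix.one_mulVec x, h1, Matrix.sum_mulVec]
    refine Finset.sum_eq_zero fun i _ => ?_
    rw [Matrix.smul_mulVec, h3, smul_zero]
  have hdet : IsUnit c.det := (Matrix.isUnit_iff_isUnit_det c).1 hcu
  have hci : c⁻¹ * c = 1 := Matrix.nonsing_inv_mul c hdet
  have hci' : c * c⁻¹ = 1 := Matrix.mul_nonsing_inv c hdet
  have hciA : ∀ x ∈ A, c⁻¹ * x = x * c⁻¹ := by
    intro x hx
    calc c⁻¹ * x = c⁻¹ * (x * c) * c⁻¹ := by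
          rw [Matrix.mul_assoc, Matrix.mul_assoc, hci', Matrix.mul_one]
      _ = _ := by rw [← hcA x hx, ← Matrix.mul_assoc, hci, Matrix.one_mul]
  let P : Matrix (Fin n) (Fin n) ℂ →ₗ[ℂ] Matrix (Fin n) (Fin n) ℂ :=
    ∑ i, LinearMap.mulLeft ℂ (c⁻¹ * a i) ∘ₗ LinearMap.mulRight ℂ (a i)ᴴ
  have hP : ∀ X, P X = c⁻¹ * ∑ i, a i * X * (a i)ᴴ := by
    intro X
    simp [P, Finset.mul_sum, LinearMap.sum_apply, Matrix.mul_assoc]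
  have hproj : LinearMap.IsProj (commutantSub (A : Set (Matrix (Fin n) (Fin n) ℂ))) P := by
    constructor
    · intro X x hx
      rw [hP, Matrix.mul_assoc, hT X x hx, ← Matrix.mul_assoc, hciA x hx, Matrix.mul_assoc]
    · intro X hX
      have hX : ∀ x ∈ A, X * x = x * X := hX
      have : ∑ i, a i * X * (a i)ᴴ = c * X := by
        rw [Finset.sum_mul]
        refine Finset.sum_congr rfl fun i _ => ?_
        have h3 : X * (a i)ᴴ = (a i)ᴴ * X := hX _ (star_mem (haA i))
        rw [Matrix.mul_assoc, h3, Matrix.mul_assoc]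
      rw [hP, this, ← Matrix.mul_assoc, hci, Matrix.one_mul]
  have htrP := hproj.trace
  have htrP2 : LinearMap.trace ℂ _ P = (c⁻¹).trace := by
    simp only [P, map_sum, trace_mulLR]
    conv_rhs => rw [← Matrix.mul_one c⁻¹, hax 1 (one_mem A)]
    simp [Finset.mul_sum, Matrix.trace_sum, mul_comm]
  rw [htrP2] at htrP
  have htrc : c.trace = Module.finrank ℂ A := by
    simp only [c, Matrix.trace_sum]
    have : ∀ i, (a i * (a i)ᴴ).trace = 1 := fun i => by
      rw [Matrix.trace_mul_comm, hao]; simp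
    simp [this]
    rfl
  set p := Module.finrank ℂ A
  set q := Module.finrank ℂ (commutantSub (A : Set (Matrix (Fin n) (Fin n) ℂ)))
  have hq : (0 : ℂ) ≤ p - 2 * (p / n) * n + (p / n) ^ 2 * q := by
    let t : ℂ := p / n
    let D : Matrix (Fin n) (Fin n) ℂ := c - t • 1
    have hDh : Dᴴ = D := by
      simp [D, t, Matrix.conjTranspose_sub, Matrix.conjTranspose_smul, hcps.1.eq]
    have h0 := (hcps.inv.conjTranspose_mul_mul_same D).trace_nonneg
    rw [hDh] at h0
    have : D * c⁻¹ * D = c - (2 * t) • 1 + t ^ 2 • c⁻¹ := by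
      simp only [D, Matrix.sub_mul, Matrix.mul_sub, hci', Matrix.smul_mul, Matrix.mul_smul,
        Matrix.one_mul, Matrix.mul_one, hci]
      module
    rw [this] at h0
    simpa [htrc, htrP, t] using h0
  have hq' : (0 : ℝ) ≤ p - 2 * (p / n) * n + (p / n) ^ 2 * q := by
    have := (Complex.le_def.1 hq).1
    have e : ((p : ℂ) - 2 * (p / n) * n + (p / n) ^ 2 * q) =
      (((p : ℝ) - 2 * (p / n) * n + (p / n) ^ 2 * q : ℝ) : ℂ) := by push_cast; rfl
    rw [e] at this
    simpa only [Complex.ofReal_re, Complex.zero_re] using this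
  have hn' : (0 : ℝ) < n := by exact_mod_cast hn
  have hp : (0 : ℝ) < p := by
    exact_mod_cast finrank_pos_alg hn A
  have h9 : (p : ℝ) - 2 * (p / n) * n + (p / n) ^ 2 * q = p / n ^ 2 * (p * q - n ^ 2) := by
    field_simp
    ring
  rw [h9] at hq'
  have := nonneg_of_mul_nonneg_right hq' (by positivity)
  have : (n : ℝ) ^ 2 ≤ p * q := by linarith
  exact_mod_cast this

end helpers

/-- if `A` is correctable and `B` is privatized to a state by a channel `Φ`
(with unital *-subalgebras `A, B ⊆ M_n`), then `dim(B) ≤ dim(A')` and `dim(A) ≤ dim(B')`. -/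
theorem stmt_17 {d n m : ℕ} (hn : 0 < n)
    (V : Fin d → Matrix (Fin m) (Fin n) ℂ)
    (hV : ∑ i, (V i)ᴴ * V i = 1)
    (A B : StarSubalgebra ℂ (Matrix (Fin n) (Fin n) ℂ))
    (hcorr : ∀ a ∈ A, ∀ i j, a * ((V i)ᴴ * V j) = ((V i)ᴴ * V j) * a)
    (hpriv : ∃ ρ : Matrix (Fin m) (Fin m) ℂ, ρ.PosSemidef ∧ ρ.trace = 1 ∧
        ∀ b ∈ B, krausMap V b = b.trace • ρ) :
    Module.finrank ℂ B ≤
        Module.finrank ℂ (commutantSub (A : Set (Matrix (Fin n) (Fin n) ℂ))) ∧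
      Module.finrank ℂ A ≤
        Module.finrank ℂ (commutantSub (B : Set (Matrix (Fin n) (Fin n) ℂ))) := by
  have h := dim_mul_le hn A B (quasi hn V hV A B hcorr hpriv)
  have hA := dim_comm hn A
  have hB := dim_comm hn B
  constructor
  · exact Nat.le_of_mul_le_mul_left (h.trans hA) (finrank_pos_alg hn A)
  · rw [mul_comm] at h
    exact Nat.le_of_mul_le_mul_left (h.trans hB) (finrank_pos_alg hn B)
end
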